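/- arXiv:2201.12780 — 8 statements merged into one kernel-verified Lean document; each statement's English description precedes it below -/
import Mathlib

section
/- Let k be an algebraically closed field of characteristic ≠ 2 and let n ≥ 2. Let M₁ and M₂ be symmetric invertible (2n+2)×(2n+2) matrices over k such that det(X·M₁ − M₂) ∈ k[X] is separable of degree 2n+2. Let G be the subgroup of GL_{2n+2}(k) consisting of all T for which there exists λ ∈ k× with T·M₁·Tᵀ = λM₁, T·M₂·Tᵀ = λM₂ and det(T) = λ^{n+1}, and let Z be the subgroup of G consisting of the scalar matrices c·I (every scalar matrix lies in G). Then Z is normal in G and the quotient group G/Z is isomorphic to (ℤ/2ℤ)^{2n}. -/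
open Matrix Polynomial
open scoped MatrixGroups

section PencilOfQuadrics

variable {ι k : Type*} [Fintype ι] [Field k]

theorem Polynomial.exists_injective_isRoot_of_separable [IsAlgClosed k] {p : k[X]}
    (hp : p.Separable) (hdeg : p.natDegree = Fintype.card ι) :
    ∃ d : ι → k, Function.Injective d ∧ ∀ i, p.IsRoot (d i) := by
  classical
  have hcard : Fintype.card ι = Fintype.card {x // x ∈ p.roots.toFinset} := by
    rw [Fintype.card_coe, Multiset.toFinset_card_of_nodup (nodup_roots hp), ← hdeg]
    exact (splits_iff_card_roots.1 (IsAlgClosed.splits p)).symm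
  let e := Fintype.equivOfCardEq hcard
  refine ⟨fun i => (e i : k), Subtype.val_injective.comp e.injective, fun i => ?_⟩
  exact isRoot_of_mem_roots (Multiset.mem_toFinset.1 (e i).2)

variable [DecidableEq ι]

theorem Matrix.eq_diagonal_of_commute_diagonal {d : ι → k} (hd : Function.Injective d)
    {T : Matrix ι ι k} (h : T * diagonal d = diagonal d * T) :
    T = diagonal fun i => T i i := by
  ext i j
  by_cases hij : i = j
  · subst hij; simp
  · rw [diagonal_apply_ne _ hij]
    have h' := congrFun (congrFun h i) j
    rw [mul_diagonal, diagonal_mul] at h'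
    have h0 : (d i - d j) * T i j = 0 := by linear_combination -h'
    exact (mul_eq_zero.1 h0).resolve_left (sub_ne_zero.2 (hd.ne hij))

/-- The two forms of a nonsingular pencil can be diagonalized simultaneously. -/
theorem Matrix.exists_simultaneous_diagonalization [IsAlgClosed k] {M₁ M₂ : Matrix ι ι k}
    (h₁ : M₁.IsSymm) (h₂ : M₂.IsSymm) (h₁u : IsUnit M₁)
    (hsep : (((X : k[X]) • M₁.map C - M₂.map C).det).Separable)
    (hdeg : (((X : k[X]) • M₁.map C - M₂.map C).det).natDegree = Fintype.card ι) :
    ∃ (S : GL ι k) (d a : ι → k), Function.Injective d ∧ (∀ i, a i ≠ 0) ∧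
      (S : Matrix ι ι k) * M₁ * (S : Matrix ι ι k)ᵀ = diagonal a ∧
      (S : Matrix ι ι k) * M₂ * (S : Matrix ι ι k)ᵀ = diagonal d * diagonal a := by
  obtain ⟨d, hd, hroot⟩ := exists_injective_isRoot_of_separable (ι := ι) hsep hdeg
  have hv : ∀ i, ∃ v : ι → k, v ≠ 0 ∧ v ᵥ* (d i • M₁ - M₂) = 0 := by
    intro i
    rw [exists_vecMul_eq_zero_iff]
    have h := hroot i
    rw [IsRoot, ← coe_evalRingHom, RingHom.map_det] at h
    rw [← h]
    congr 1
    ext a b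
    simp
    ring
  choose v hv0 hv using hv
  have hvM : ∀ i, v i ᵥ* M₂ = d i • (v i ᵥ* M₁) := fun i => by
    have := hv i
    rw [vecMul_sub, vecMul_smul, sub_eq_zero] at this
    exact this.symm
  have hdet : IsUnit M₁.det := (isUnit_iff_isUnit_det M₁).1 h₁u
  have hli : LinearIndependent k v := by
    refine Module.End.eigenvectors_linearIndependent' (Matrix.vecMulLinear (M₂ * M₁⁻¹)) d hd v
      fun i => ?_
    rw [Module.End.hasEigenvector_iff, Module.End.mem_eigenspace_iff]
    refine ⟨?_, hv0 i⟩
    rw [vecMulLinear_apply, ← vecMul_vecMul, hvM, smul_vecMul, vecMul_vecMul,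
      mul_nonsing_inv _ hdet, vecMul_one]
  have hu : IsUnit (Matrix.of v) := linearIndependent_rows_iff_isUnit.1 hli
  obtain ⟨S, hS⟩ := hu
  have hSM : (S : Matrix ι ι k) * M₂ = diagonal d * ((S : Matrix ι ι k) * M₁) := by
    ext i j
    rw [diagonal_mul, hS]
    exact congrFun (hvM i) j
  have hSM' : (S : Matrix ι ι k) * M₂ * (S : Matrix ι ι k)ᵀ =
      diagonal d * ((S : Matrix ι ι k) * M₁ * (S : Matrix ι ι k)ᵀ) := by
    rw [hSM, Matrix.mul_assoc]
  have hcomm : ((S : Matrix ι ι k) * M₁ * (S : Matrix ι ι k)ᵀ) * diagonal d =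
      diagonal d * ((S : Matrix ι ι k) * M₁ * (S : Matrix ι ι k)ᵀ) := by
    have := congrArg Matrix.transpose hSM'
    simp only [transpose_mul, transpose_transpose, h₁.eq, h₂.eq, diagonal_transpose] at this
    rw [← hSM', Matrix.mul_assoc (S : Matrix ι ι k) M₂, this]
    simp only [Matrix.mul_assoc]
  have hdiag := eq_diagonal_of_commute_diagonal hd hcomm
  refine ⟨S, d, _, hd, ?_, hdiag, ?_⟩
  · have hSu : IsUnit (S : Matrix ι ι k) := S.isUnit
    have := (hSu.mul h₁u).mul ((isUnit_transpose _).2 hSu)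
    rw [hdiag, isUnit_diagonal, Pi.isUnit_iff] at this
    exact fun i => (this i).ne_zero
  · rw [hSM', ← hdiag]

/-- Similitudes of a diagonal pencil with distinct roots are diagonal, with entries the square
roots of the multiplier. -/
theorem Matrix.exists_eq_diagonal_of_similitude {d a : ι → k} (hd : Function.Injective d)
    (ha : ∀ i, a i ≠ 0) {T : Matrix ι ι k} (hT : IsUnit T) {lam : k}
    (hT₁ : T * diagonal a * Tᵀ = lam • diagonal a)
    (hT₂ : T * (diagonal d * diagonal a) * Tᵀ = lam • (diagonal d * diagonal a)) :
    T = diagonal (fun i => T i i) ∧ ∀ i, T i i ^ 2 = lam := by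
  have hau : IsUnit (diagonal a) := by
    rw [isUnit_diagonal, Pi.isUnit_iff]
    exact fun i => (ha i).isUnit
  have hcomm : T * diagonal d = diagonal d * T := by
    refine hau.mul_right_cancel (((isUnit_transpose T).2 hT).mul_right_cancel ?_)
    rw [Matrix.mul_assoc T, hT₂, Matrix.mul_assoc _ T, Matrix.mul_assoc _ (T * _), hT₁,
      Matrix.mul_smul]
  have hdiag := eq_diagonal_of_commute_diagonal hd hcomm
  refine ⟨hdiag, fun i => ?_⟩
  have h := congrFun (congrFun hT₁ i) i
  rw [hdiag, diagonal_transpose, diagonal_mul_diagonal, diagonal_mul_diagonal] at h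
  simp only [diagonal_apply_eq, smul_apply, smul_eq_mul] at h
  exact mul_right_cancel₀ (ha i) (by linear_combination h)

end PencilOfQuadrics

/-- For a nonsingular pencil of quadrics on a `(2n+2)`-dimensional space over an algebraically
closed field of characteristic ≠ 2, the group `Aut⁺_Q = Sim⁺_Q / 𝔾_m` of automorphisms of the
pencil (similitudes with `det = λ^{n+1}`, modulo scalars) is isomorphic to `(ℤ/2ℤ)^{2n}`. -/
theorem stmt_2 (k : Type*) [Field k] [IsAlgClosed k] (hchar : ringChar k ≠ 2)
    (n : ℕ) (hn : 2 ≤ n)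
    (M₁ M₂ : Matrix (Fin (2 * n + 2)) (Fin (2 * n + 2)) k)
    (h₁ : M₁.IsSymm) (h₂ : M₂.IsSymm) (h₁u : IsUnit M₁) (h₂u : IsUnit M₂)
    (hsep : (((X : k[X]) • M₁.map C - M₂.map C).det).Separable)
    (hdeg : (((X : k[X]) • M₁.map C - M₂.map C).det).natDegree = 2 * n + 2)
    (G : Subgroup (GL (Fin (2 * n + 2)) k))
    (hG : ∀ T : GL (Fin (2 * n + 2)) k, T ∈ G ↔ ∃ lam : k, lam ≠ 0 ∧
      (T : Matrix (Fin (2 * n + 2)) (Fin (2 * n + 2)) k) * M₁ *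
        (T : Matrix (Fin (2 * n + 2)) (Fin (2 * n + 2)) k)ᵀ = lam • M₁ ∧
      (T : Matrix (Fin (2 * n + 2)) (Fin (2 * n + 2)) k) * M₂ *
        (T : Matrix (Fin (2 * n + 2)) (Fin (2 * n + 2)) k)ᵀ = lam • M₂ ∧
      (T : Matrix (Fin (2 * n + 2)) (Fin (2 * n + 2)) k).det = lam ^ (n + 1))
    (Z : Subgroup G)
    (hZ : ∀ T : G, T ∈ Z ↔ ∃ c : k,
      ((T : GL (Fin (2 * n + 2)) k) : Matrix (Fin (2 * n + 2)) (Fin (2 * n + 2)) k) =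
        c • (1 : Matrix (Fin (2 * n + 2)) (Fin (2 * n + 2)) k)) :
    Z.Normal ∧ ∀ h : Z.Normal, haveI := h
      Nonempty ((G ⧸ Z) ≃* Multiplicative (Fin (2 * n) → ZMod 2)) := by
  have h2 : (2 : k) ≠ 0 := Ring.two_ne_zero hchar
  obtain ⟨S, d, a, hd, ha, hS₁, hS₂⟩ :=
    Matrix.exists_simultaneous_diagonalization h₁ h₂ h₁u hsep (by simpa using hdeg)
  have hSu : IsUnit (S : Matrix (Fin (2 * n + 2)) (Fin (2 * n + 2)) k) := S.isUnit
  have hSt := (isUnit_transpose _).2 hSu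
  let conj : GL (Fin (2 * n + 2)) k →* GL (Fin (2 * n + 2)) k := (MulAut.conj S).toMonoidHom
  have hconjS : ∀ T, conj T * S = S * T := fun T => by simp [conj]
  have hform : ∀ (T : GL (Fin (2 * n + 2)) k) (M : Matrix (Fin (2 * n + 2)) (Fin (2 * n + 2)) k)
      (lam : k), T.val * M * T.valᵀ = lam • M ↔
        (conj T).val * (S.val * M * S.valᵀ) * (conj T).valᵀ = lam • (S.val * M * S.valᵀ) := by
    intro T M lam
    have hc : (conj T).val * S.val = S.val * T.val := congrArg Units.val (hconjS T)
    have : (conj T).val * (S.val * M * S.valᵀ) * (conj T).valᵀ =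
        S.val * (T.val * M * T.valᵀ) * S.valᵀ := by
      calc _ = ((conj T).val * S.val) * M * ((conj T).val * S.val)ᵀ := by
            rw [transpose_mul]; simp only [Matrix.mul_assoc]
        _ = _ := by rw [hc, transpose_mul]; simp only [Matrix.mul_assoc]
    rw [this]
    constructor
    · intro h
      rw [h, Matrix.mul_smul, Matrix.smul_mul]
    · intro h
      refine hSu.mul_left_cancel (hSt.mul_right_cancel ?_)
      rw [h, Matrix.mul_smul, Matrix.smul_mul]
  have hdetconj : ∀ T, (conj T).val.det = T.val.det := fun T => by
    have hc : (conj T).val * S.val = S.val * T.val := congrArg Units.val (hconjS T)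
    have := congrArg Matrix.det hc
    rw [det_mul, det_mul, mul_comm] at this
    exact mul_left_cancel₀ ((isUnit_iff_isUnit_det _).1 hSu).ne_zero this
  let e : GL (Fin (2 * n + 2)) k → Fin (2 * n + 2) → k := fun T i => (conj T).val i i
  have hGe : ∀ T ∈ G, (conj T).val = diagonal (e T) ∧ ∃ lam : k, lam ≠ 0 ∧
      (∀ i, e T i ^ 2 = lam) ∧ ∏ i, e T i = lam ^ (n + 1) := by
    intro T hT
    obtain ⟨lam, hlam, hT₁, hT₂, hdet⟩ := (hG T).1 hT
    rw [hform, hS₁] at hT₁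
    rw [hform, hS₂] at hT₂
    obtain ⟨hdiag, hsq⟩ :=
      Matrix.exists_eq_diagonal_of_similitude hd ha (conj T).isUnit hT₁ hT₂
    refine ⟨hdiag, lam, hlam, hsq, ?_⟩
    rw [← hdet, ← hdetconj, hdiag, det_diagonal]
  have hGe' : ∀ (T : GL (Fin (2 * n + 2)) k) (w : Fin (2 * n + 2) → k),
      (conj T).val = diagonal w → (∀ i, w i ^ 2 = 1) → ∏ i, w i = 1 → T ∈ G := by
    intro T w hw hsq hprod
    refine (hG T).2 ⟨1, one_ne_zero, ?_, ?_, ?_⟩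
    · rw [hform, hS₁, hw, diagonal_transpose, diagonal_mul_diagonal, diagonal_mul_diagonal,
        one_smul]
      congr 1; ext i; linear_combination a i * hsq i
    · rw [hform, hS₂, hw, diagonal_transpose]
      simp only [diagonal_mul_diagonal, one_smul]
      congr 1; ext i; linear_combination d i * a i * hsq i
    · rw [← hdetconj, hw, det_diagonal, hprod, one_pow]
  have hne : ∀ T ∈ G, ∀ i, e T i ≠ 0 := by
    intro T hT i h0
    obtain ⟨-, lam, hlam, hsq, -⟩ := hGe T hT
    apply hlam
    rw [← hsq i, h0]; ring
  have hpm : ∀ T ∈ G, ∀ i, e T i = e T 0 ∨ e T i = -e T 0 := by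
    intro T hT i
    obtain ⟨-, lam, hlam, hsq, -⟩ := hGe T hT
    exact sq_eq_sq_iff_eq_or_eq_neg.1 ((hsq i).trans (hsq 0).symm)
  have hemul : ∀ T ∈ G, ∀ T' ∈ G, ∀ i, e (T * T') i = e T i * e T' i := by
    intro T hT T' hT' i
    have : (conj (T * T')).val = (conj T).val * (conj T').val := by simp
    change (conj (T * T')).val i i = _
    rw [this, (hGe T hT).1, (hGe T' hT').1, diagonal_mul_diagonal, diagonal_apply_eq]
  classical
  let f : G →* Multiplicative (Fin (2 * n) → ZMod 2) := MonoidHom.mk'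
    (fun T => Multiplicative.ofAdd fun i : Fin (2 * n) =>
      if e T i.castSucc.succ = e T 0 then 0 else 1) (by
    intro T T'
    rw [← ofAdd_add]
    congr 1
    ext1 i
    simp only [Pi.add_apply, Subgroup.coe_mul, hemul T T.2 T' T'.2]
    have h0 := hne T T.2 0
    have h0' := hne T' T'.2 0
    have hneg : ∀ x : k, x ≠ 0 → -x ≠ x := fun x hx h =>
      (mul_ne_zero h2 hx) (by linear_combination -h)
    have h11 : (1 : ZMod 2) + 1 = 0 := by decide
    rcases hpm T T.2 i.castSucc.succ with h | h <;>
      rcases hpm T' T'.2 i.castSucc.succ with h' | h' <;>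
      simp only [h, h', neg_neg, neg_mul, mul_neg, hneg _ h0, hneg _ h0',
        hneg _ (mul_ne_zero h0 h0'), if_true, if_false, add_zero, zero_add, h11])
  have hfone : ∀ T : G, f T = 1 ↔ ∀ i : Fin (2 * n), e T i.castSucc.succ = e T 0 := by
    intro T
    change (Multiplicative.ofAdd fun i : Fin (2 * n) =>
      if e T i.castSucc.succ = e T 0 then (0 : ZMod 2) else 1) = 1 ↔ _
    rw [ofAdd_eq_one, funext_iff]
    simp
  have hker : f.ker = Z := by
    ext T
    rw [MonoidHom.mem_ker, hfone, hZ]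
    obtain ⟨hdiag, lam, hlam, hsq, hprod⟩ := hGe T T.2
    have hc : (conj T.1).val * S.val = S.val * T.1.val := congrArg Units.val (hconjS T)
    constructor
    · intro h
      have hlast : e T (Fin.last (2 * n)).succ = e T 0 := by
        rw [Fin.prod_univ_succ, Fin.prod_univ_castSucc] at hprod
        simp only [h, Finset.prod_const, Finset.card_univ, Fintype.card_fin] at hprod
        rw [← hsq 0] at hprod
        refine mul_left_cancel₀ (pow_ne_zero (2 * n + 1) (hne T T.2 0)) ?_
        linear_combination hprod
      have hall : ∀ i, e T i = e T 0 := by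
        intro i
        induction i using Fin.cases with
        | zero => rfl
        | succ i =>
          induction i using Fin.lastCases with
          | last => exact hlast
          | cast i => exact h i
      refine ⟨e T 0, hSu.mul_left_cancel ?_⟩
      rw [← hc, hdiag, show e T = fun _ => e T 0 from funext hall, ← smul_one_eq_diagonal]
      simp
    · rintro ⟨c, hTc⟩ i
      have : (conj T.1).val = c • 1 := by
        refine hSu.mul_right_cancel ?_
        rw [hc, hTc]; simp
      simp [e, this]
  have hsurj : Function.Surjective f := by
    intro y
    let s : Fin (2 * n) → k := fun i => if y.toAdd i = 0 then 1 else -1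
    have hs : ∀ i, s i ^ 2 = 1 := fun i => by
      simp only [s]; split_ifs <;> ring
    let w : Fin (2 * n + 2) → k := Fin.cons 1 (Fin.snoc (α := fun _ => k) s (∏ i, s i))
    have hw : ∀ i, w i ^ 2 = 1 := by
      intro i
      induction i using Fin.cases with
      | zero => simp [w]
      | succ i =>
        induction i using Fin.lastCases with
        | last => simp [w, ← Finset.prod_pow, hs]
        | cast i => simp [w, hs]
    have hprod : ∏ i, w i = 1 := by
      rw [Fin.prod_univ_succ, Fin.prod_univ_castSucc]
      simp only [w, Fin.cons_zero, Fin.cons_succ, Fin.snoc_castSucc, Fin.snoc_last, one_mul]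
      rw [← sq, ← Finset.prod_pow]
      simp [hs]
    have hww : diagonal w * diagonal w = 1 := by
      rw [diagonal_mul_diagonal, ← diagonal_one]
      congr 1; ext i; simpa [sq] using hw i
    let W : GL (Fin (2 * n + 2)) k := ⟨diagonal w, diagonal w, hww, hww⟩
    have hW : conj (S⁻¹ * W * S) = W := by simp [conj, mul_assoc]
    have hWv : (conj (S⁻¹ * W * S)).val = diagonal w := congrArg Units.val hW
    refine ⟨⟨S⁻¹ * W * S, hGe' _ w hWv hw hprod⟩, ?_⟩
    have he : e (S⁻¹ * W * S) = w := by
      ext i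
      change (conj (S⁻¹ * W * S)).val i i = _
      rw [hWv, diagonal_apply_eq]
    change (Multiplicative.ofAdd fun i : Fin (2 * n) =>
      if e (S⁻¹ * W * S) i.castSucc.succ = e (S⁻¹ * W * S) 0 then (0 : ZMod 2) else 1) = y
    rw [he]
    apply Multiplicative.toAdd.injective
    ext1 i
    have hneg : (-1 : k) ≠ 1 := fun h => h2 (by linear_combination -h)
    have hz : ∀ z : ZMod 2, z = 0 ∨ z = 1 := by decide
    rcases hz (y.toAdd i) with h | h <;> simp [w, s, h, hneg]
  subst hker
  exact ⟨inferInstance, fun _ => ⟨QuotientGroup.quotientKerEquivOfSurjective f hsurj⟩⟩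
end

section
/- Let k be a field, m ≥ 1, and let M₁, M₂ be symmetric m×m matrices over k with M₁ invertible and det(X·M₁ − M₂) ∈ k[X] separable of degree m. Let u = M₂·M₁⁻¹ and let k[u] ⊆ M_m(k) be the k-subalgebra generated by u. Then for α ∈ GL_m(k) and λ ∈ k×, the following are equivalent: (i) α·M₁·αᵀ = λM₁ and α·M₂·αᵀ = λM₂; (ii) α ∈ k[u] and α² = λ·I. -/
open Matrix Polynomial

namespace Matrix

variable {n R : Type*} [Fintype n] [CommRing R]

lemma map_snd_mul_dualNumber (A B : Matrix n n (DualNumber R)) :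
    (A * B).map TrivSqZeroExt.snd =
      A.map TrivSqZeroExt.fst * B.map TrivSqZeroExt.snd +
        A.map TrivSqZeroExt.snd * B.map TrivSqZeroExt.fst := by
  ext i j
  simp [Matrix.mul_apply, TrivSqZeroExt.snd_sum, Finset.sum_add_distrib, mul_comm]

variable [DecidableEq n]

/-- First-order Taylor expansion of a polynomial at a dual-number matrix whose two components
commute: the infinitesimal part is the derivative term up to a polynomial in the first component. -/
lemma exists_map_snd_aeval_dualNumber (N : Matrix n n (DualNumber R))
    (hN : Commute (N.map TrivSqZeroExt.fst) (N.map TrivSqZeroExt.snd)) (P : (DualNumber R)[X]) :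
    (aeval N P).map TrivSqZeroExt.fst =
        aeval (N.map TrivSqZeroExt.fst) (P.map (TrivSqZeroExt.fstHom R R R : DualNumber R →+* R)) ∧
      ∃ g : R[X], (aeval N P).map TrivSqZeroExt.snd =
        aeval (N.map TrivSqZeroExt.fst)
            (derivative (P.map (TrivSqZeroExt.fstHom R R R : DualNumber R →+* R))) *
          N.map TrivSqZeroExt.snd + aeval (N.map TrivSqZeroExt.fst) g := by
  have fst_mul (A B : Matrix n n (DualNumber R)) : (A * B).map TrivSqZeroExt.fst =
      A.map TrivSqZeroExt.fst * B.map TrivSqZeroExt.fst :=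
    Matrix.map_mul (f := (TrivSqZeroExt.fstHom R R R : DualNumber R →+* R))
  induction P using Polynomial.induction_on with
  | C a =>
    refine ⟨?_, C a.snd, ?_⟩ <;>
    · ext i j
      by_cases h : i = j <;> simp [Matrix.algebraMap_matrix_apply, h]
  | add p q hp hq =>
    obtain ⟨hp, g, hg⟩ := hp
    obtain ⟨hq, g', hg'⟩ := hq
    refine ⟨?_, g + g', ?_⟩
    · rw [map_add, Matrix.map_add _ TrivSqZeroExt.fst_add, hp, hq, Polynomial.map_add, map_add]
    · rw [map_add, Matrix.map_add _ TrivSqZeroExt.snd_add, hg, hg', Polynomial.map_add]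
      simp only [map_add, add_mul]
      abel
  | monomial d a h =>
    obtain ⟨h, g, hg⟩ := h
    rw [pow_succ, ← mul_assoc, map_mul, aeval_X, Polynomial.map_mul, Polynomial.map_X]
    refine ⟨?_, g * X, ?_⟩
    · rw [fst_mul, h, map_mul, aeval_X]
    · rw [map_snd_mul_dualNumber, h, hg, derivative_mul, derivative_X]
      simp only [map_add, map_mul, aeval_X, mul_one, add_mul, mul_assoc, hN.eq]
      abel

/-- By Cayley–Hamilton for `u + εα`, multiplying by the derivative of the characteristic polynomial
at `u` sends the commutant of `u` into the polynomials in `u`. -/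
lemma exists_aeval_derivative_charpoly_mul (u α : Matrix n n R) (h : Commute u α) :
    ∃ g : R[X], aeval u (derivative u.charpoly) * α = aeval u g := by
  let N : Matrix n n (DualNumber R) := .of fun i j => (u i j, α i j)
  have h1 : N.map TrivSqZeroExt.fst = u := rfl
  have h2 : N.map TrivSqZeroExt.snd = α := rfl
  have h3 : N.charpoly.map (TrivSqZeroExt.fstHom R R R : DualNumber R →+* R) = u.charpoly :=
    (Matrix.charpoly_map N _).symm
  obtain ⟨-, g, hg⟩ := exists_map_snd_aeval_dualNumber N (by rwa [h1, h2]) N.charpoly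
  rw [h1, h2, h3, Matrix.aeval_self_charpoly, Matrix.map_zero _ TrivSqZeroExt.snd_zero] at hg
  exact ⟨-g, by rw [map_neg]; exact eq_neg_of_add_eq_zero_left hg.symm⟩

/-- A matrix with separable characteristic polynomial generates its own commutant. -/
lemma mem_adjoin_of_commute_of_separable_charpoly {u α : Matrix n n R} (h : Commute u α)
    (hu : u.charpoly.Separable) : α ∈ Algebra.adjoin R {u} := by
  obtain ⟨g, hg⟩ := exists_aeval_derivative_charpoly_mul u α h
  obtain ⟨a, b, hab⟩ := hu
  have hb : aeval u b * aeval u (derivative u.charpoly) = 1 := by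
    simpa [Matrix.aeval_self_charpoly] using congrArg (aeval u) hab
  have hα : α = aeval u (b * g) := by
    rw [map_mul, ← hg, ← mul_assoc, hb, one_mul]
  rw [hα]
  exact aeval_mem_adjoin_singleton R u

lemma det_X_smul_sub_eq_charpoly_mul (A B : Matrix n n R) (hA : IsUnit A) :
    ((X : R[X]) • A.map C - B.map C).det = (B * A⁻¹).charpoly * C A.det := by
  have hB : B * A⁻¹ * A = B := by
    rw [mul_assoc, Matrix.nonsing_inv_mul _ ((Matrix.isUnit_iff_isUnit_det A).1 hA), mul_one]
  have hC : (C A.det : R[X]) = (A.map C).det := RingHom.map_det C A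
  rw [Matrix.charpoly, hC, ← Matrix.det_mul]
  congr 1
  have hm : B.map (C : R →+* R[X]) = (B * A⁻¹).map C * A.map C := by
    rw [← Matrix.map_mul, hB]
  rw [charmatrix, sub_mul, hm]
  simp [Matrix.smul_eq_diagonal_mul]

/-- Elements of `R[B A⁻¹]` are self-adjoint for the symmetric form `A`. -/
lemma mul_transpose_eq_of_mem_adjoin {A B α : Matrix n n R} (hA : A.IsSymm) (hB : B.IsSymm)
    (hu : IsUnit A) (hα : α ∈ Algebra.adjoin R {B * A⁻¹}) : A * αᵀ = α * A := by
  have hdet := (Matrix.isUnit_iff_isUnit_det A).1 hu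
  induction hα using Algebra.adjoin_induction with
  | mem x hx =>
    obtain rfl := hx
    rw [Matrix.transpose_mul, Matrix.transpose_nonsing_inv, hA.eq, hB.eq, ← mul_assoc,
      Matrix.mul_nonsing_inv _ hdet, one_mul, mul_assoc, Matrix.nonsing_inv_mul _ hdet, mul_one]
  | algebraMap r =>
    simp [Algebra.algebraMap_eq_smul_one]
  | add x y _ _ hx hy => rw [Matrix.transpose_add, mul_add, hx, hy, add_mul]
  | mul x y hxm hym hx hy =>
    rw [Matrix.transpose_mul, ← mul_assoc, hy, mul_assoc, hx, ← mul_assoc]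
    rw [(Algebra.commute_of_mem_adjoin_singleton_of_commute hxm
      (Algebra.commute_of_mem_adjoin_self hym).symm).eq]

end Matrix

/-- For a nonsingular pencil `t·Q₁ − Q₂` on `k^m` with `u = M₂·M₁⁻¹`, an invertible matrix
`α` is a similitude of the pencil with multiplier `λ` (i.e. `αM₁αᵀ = λM₁` and `αM₂αᵀ = λM₂`)
if and only if `α` lies in the étale algebra `k[u]` and `α² = λ·I`. -/
theorem stmt_7 (k : Type*) [Field k] (m : ℕ) (hm : 1 ≤ m)
    (M₁ M₂ : Matrix (Fin m) (Fin m) k)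
    (h₁ : M₁.IsSymm) (h₂ : M₂.IsSymm) (hM₁ : IsUnit M₁)
    (hsep : (((X : k[X]) • M₁.map C - M₂.map C).det).Separable)
    (hdeg : (((X : k[X]) • M₁.map C - M₂.map C).det).natDegree = m)
    (α : Matrix (Fin m) (Fin m) k) (hα : IsUnit α) (lam : k) (hlam : lam ≠ 0) :
    (α * M₁ * αᵀ = lam • M₁ ∧ α * M₂ * αᵀ = lam • M₂) ↔
    (α ∈ Algebra.adjoin k {M₂ * M₁⁻¹} ∧
      α * α = lam • (1 : Matrix (Fin m) (Fin m) k)) := by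
  have hdet := (Matrix.isUnit_iff_isUnit_det M₁).1 hM₁
  have hu : M₂ * M₁⁻¹ * M₁ = M₂ := by
    rw [mul_assoc, Matrix.nonsing_inv_mul _ hdet, mul_one]
  constructor
  · rintro ⟨e₁, e₂⟩
    have hc : Commute (M₂ * M₁⁻¹) α := by
      have hMα : IsUnit (M₁ * αᵀ) := hM₁.mul ((Matrix.isUnit_transpose α).2 hα)
      refine hMα.mul_right_cancel ?_
      calc M₂ * M₁⁻¹ * α * (M₁ * αᵀ) = M₂ * M₁⁻¹ * (α * M₁ * αᵀ) := by simp only [mul_assoc]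
        _ = α * M₂ * αᵀ := by rw [e₁, e₂, Matrix.mul_smul, hu]
        _ = α * (M₂ * M₁⁻¹ * M₁) * αᵀ := by rw [hu]
        _ = α * (M₂ * M₁⁻¹) * (M₁ * αᵀ) := by simp only [mul_assoc]
    rw [Matrix.det_X_smul_sub_eq_charpoly_mul M₁ M₂ hM₁] at hsep
    have hmem := Matrix.mem_adjoin_of_commute_of_separable_charpoly hc hsep.of_mul_left
    refine ⟨hmem, hM₁.mul_right_cancel ?_⟩
    rw [mul_assoc, ← Matrix.mul_transpose_eq_of_mem_adjoin h₁ h₂ hM₁ hmem, ← mul_assoc, e₁,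
      Matrix.smul_mul, one_mul]
  · rintro ⟨hmem, hsq⟩
    have hs := Matrix.mul_transpose_eq_of_mem_adjoin h₁ h₂ hM₁ hmem
    have e₁ : α * M₁ * αᵀ = lam • M₁ := by
      rw [mul_assoc, hs, ← mul_assoc, hsq, Matrix.smul_mul, one_mul]
    refine ⟨e₁, ?_⟩
    calc α * M₂ * αᵀ = α * (M₂ * M₁⁻¹ * M₁) * αᵀ := by rw [hu]
      _ = α * (M₂ * M₁⁻¹) * M₁ * αᵀ := by simp only [mul_assoc]
      _ = M₂ * M₁⁻¹ * (α * M₁ * αᵀ) := by rw [← (Algebra.commute_of_mem_adjoin_self hmem).eq]; simp only [mul_assoc]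
      _ = lam • M₂ := by rw [e₁, Matrix.mul_smul, hu]
end

section
/- Let k be a field of characteristic ≠ 2, n ≥ 0, and let f ∈ k[X] be a monic separable polynomial of degree 2n+2. Let L = k[X]/(f) with β the image of X, so that {1, β, …, β^{2n+1}} is a k-basis of L. Define the bilinear form b₁ : L × L → k by b₁(x, y) = (the coefficient of β^{2n+1} in the expansion of x·y in this basis), and define b₂(x, y) = b₁(β·x, y). Then: b₁ is symmetric and nondegenerate; multiplication by β is self-adjoint for b₁, i.e. b₁(β·x, y) = b₁(x, β·y) for all x, y ∈ L (so b₂ is also symmetric); and if G₁, G₂ denote the Gram matrices of b₁ and b₂ with respect to the basis {1, β, …, β^{2n+1}}, then det(X·G₁ − G₂) = (−1)^{n+1}·f(X) in k[X]. -/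
open Polynomial

/-- The coefficient of `β^d` in the expansion of an element of `L = k[X]/(f)` with respect to
the power basis `1, β, …, β^{deg f − 1}`, where `β` is the image of `X`. -/
noncomputable def powerCoeff {k : Type*} [Field k] {f : k[X]} (hf : f.Monic) (d : ℕ)
    (x : AdjoinRoot f) : k :=
  (AdjoinRoot.modByMonicHom hf x).coeff d

/-- The Arul–Shankar–Wang bilinear form `b₁(x, y) = coefficient of β^{2n+1} in x·y` on
`L = k[X]/(f)`, `f` monic separable of degree `2n+2`. -/
noncomputable def aswB1 {k : Type*} [Field k] (n : ℕ) {f : k[X]} (hf : f.Monic)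
    (x y : AdjoinRoot f) : k :=
  powerCoeff hf (2 * n + 1) (x * y)

/-- The second Arul–Shankar–Wang bilinear form `b₂(x, y) = b₁(β·x, y)`. -/
noncomputable def aswB2 {k : Type*} [Field k] (n : ℕ) {f : k[X]} (hf : f.Monic)
    (x y : AdjoinRoot f) : k :=
  aswB1 n hf (AdjoinRoot.root f * x) y

/-- The Gram matrix of `b₁` with respect to the power basis `1, β, …, β^{2n+1}`. -/
noncomputable def aswG1 {k : Type*} [Field k] (n : ℕ) {f : k[X]} (hf : f.Monic) :
    Matrix (Fin (2 * n + 2)) (Fin (2 * n + 2)) k :=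
  Matrix.of fun i j => aswB1 n hf (AdjoinRoot.root f ^ (i : ℕ)) (AdjoinRoot.root f ^ (j : ℕ))

/-- The Gram matrix of `b₂` with respect to the power basis `1, β, …, β^{2n+1}`. -/
noncomputable def aswG2 {k : Type*} [Field k] (n : ℕ) {f : k[X]} (hf : f.Monic) :
    Matrix (Fin (2 * n + 2)) (Fin (2 * n + 2)) k :=
  Matrix.of fun i j => aswB2 n hf (AdjoinRoot.root f ^ (i : ℕ)) (AdjoinRoot.root f ^ (j : ℕ))

/-- The determinant of a matrix that vanishes above the antidiagonal and is `1` on it. -/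
theorem Matrix.det_of_antitriangular {R : Type*} [CommRing R] {m : ℕ}
    (M : Matrix (Fin m) (Fin m) R)
    (h0 : ∀ i j : Fin m, (i : ℕ) + j + 1 < m → M i j = 0)
    (h1 : ∀ i j : Fin m, (i : ℕ) + j + 1 = m → M i j = 1) :
    M.det = ∏ i ∈ Finset.range m, (-1 : R) ^ i := by
  induction m with
  | zero => simp
  | succ m ih =>
    rw [Matrix.det_succ_row_zero, Finset.sum_eq_single (Fin.last m), Finset.prod_range_succ,
      ih (M.submatrix Fin.succ (Fin.last m).succAbove), h1 0 (Fin.last m) (by simp)]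
    · simp [mul_comm]
    · intro i j hij
      exact h0 _ _ (by simp; omega)
    · intro i j hij
      exact h1 _ _ (by simp; omega)
    · intro j _ hj
      have := Fin.val_lt_last hj
      rw [h0 0 j (by simpa using this)]
      simp
    · simp

theorem prod_range_neg_one_pow {R : Type*} [CommRing R] (n : ℕ) :
    ∏ i ∈ Finset.range (2 * n), (-1 : R) ^ i = (-1) ^ n := by
  induction n with
  | zero => simp
  | succ n ih =>
    rw [show 2 * (n + 1) = 2 * n + 1 + 1 by ring, Finset.prod_range_succ, Finset.prod_range_succ,
      ih]
    simp [pow_succ, pow_mul]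

section

variable {k : Type*} [Field k] {f : k[X]}

theorem powerCoeff_mk_of_degree_lt (hf : f.Monic) (d : ℕ) {p : k[X]} (hp : p.degree < f.degree) :
    powerCoeff hf d (AdjoinRoot.mk f p) = p.coeff d := by
  rw [powerCoeff, AdjoinRoot.modByMonicHom_mk, (modByMonic_eq_self_iff hf).mpr hp]

theorem powerCoeff_root_pow (hf : f.Monic) (d : ℕ) {m : ℕ} (hm : m < f.natDegree) :
    powerCoeff hf d (AdjoinRoot.root f ^ m) = if d = m then 1 else 0 := by
  have hp : (X ^ m : k[X]).degree < f.degree := by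
    rw [degree_X_pow, degree_eq_natDegree hf.ne_zero]
    exact_mod_cast hm
  rw [← AdjoinRoot.mk_X, ← map_pow, powerCoeff_mk_of_degree_lt hf d hp, coeff_X_pow]

theorem AdjoinRoot.charpoly_leftMulMatrix_root (hf : f.Monic) {ι : Type*} [Fintype ι]
    [DecidableEq ι] (b : Module.Basis ι k (AdjoinRoot f)) :
    (Algebra.leftMulMatrix b (AdjoinRoot.root f)).charpoly = f := by
  have := hf.finite_adjoinRoot
  have h := charpoly_leftMulMatrix (AdjoinRoot.powerBasis' hf)
  rw [AdjoinRoot.powerBasis'_gen, AdjoinRoot.minpoly_root hf.ne_zero, hf.leadingCoeff, inv_one,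
    C_1, mul_one, Algebra.leftMulMatrix_apply, LinearMap.charpoly_toMatrix] at h
  rw [Algebra.leftMulMatrix_apply, LinearMap.charpoly_toMatrix, h]

theorem aswB1_comm (n : ℕ) (hf : f.Monic) (x y : AdjoinRoot f) :
    aswB1 n hf x y = aswB1 n hf y x := by
  rw [aswB1, aswB1, mul_comm x y]

theorem aswB1_root_mul_left (n : ℕ) (hf : f.Monic) (x y : AdjoinRoot f) :
    aswB1 n hf (AdjoinRoot.root f * x) y = aswB1 n hf x (AdjoinRoot.root f * y) := by
  rw [aswB1, aswB1, mul_assoc, mul_left_comm]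

theorem aswB1_sum_smul_left (n : ℕ) (hf : f.Monic) {ι : Type*} (s : Finset ι) (c : ι → k)
    (x : ι → AdjoinRoot f) (y : AdjoinRoot f) :
    aswB1 n hf (∑ i ∈ s, c i • x i) y = ∑ i ∈ s, c i * aswB1 n hf (x i) y := by
  simp [aswB1, powerCoeff, Finset.sum_mul, finsetSum_coeff]

theorem eq_zero_of_forall_aswB1_eq_zero {n : ℕ} (hf : f.Monic) (hdeg : f.natDegree = 2 * n + 2)
    {x : AdjoinRoot f} (hx : ∀ y, aswB1 n hf x y = 0) : x = 0 := by
  by_contra hne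
  set p := AdjoinRoot.modByMonicHom hf x with hp
  have hpx : AdjoinRoot.mk f p = x := AdjoinRoot.mk_leftInverse hf x
  have hp0 : p ≠ 0 := by
    intro h
    rw [h, map_zero] at hpx
    exact hne hpx.symm
  have hlt : p.natDegree < 2 * n + 2 := by
    have h : p.degree < f.degree := by
      have : p = p %ₘ f := by rw [← AdjoinRoot.modByMonicHom_mk hf, hpx]
      rw [this]
      exact degree_modByMonic_lt _ hf
    rw [← hdeg]
    exact natDegree_lt_natDegree hp0 h
  set e := 2 * n + 1 - p.natDegree with he
  have hdlt : (p * X ^ e).degree < f.degree := by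
    rw [degree_mul, degree_X_pow, degree_eq_natDegree hp0, degree_eq_natDegree hf.ne_zero, hdeg]
    exact_mod_cast (by omega : p.natDegree + e < 2 * n + 2)
  have h := hx (AdjoinRoot.root f ^ e)
  rw [aswB1, ← hpx, ← AdjoinRoot.mk_X, ← map_pow, ← map_mul,
    powerCoeff_mk_of_degree_lt hf _ hdlt, show 2 * n + 1 = p.natDegree + e by omega,
    coeff_mul_X_pow] at h
  exact hp0 (leadingCoeff_eq_zero.mp h)

theorem det_aswG1 {n : ℕ} (hf : f.Monic) (hdeg : f.natDegree = 2 * n + 2) :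
    (aswG1 n hf).det = (-1) ^ (n + 1) := by
  rw [Matrix.det_of_antitriangular, ← prod_range_neg_one_pow (n + 1)]
  · rfl
  all_goals
    intro i j hij
    rw [aswG1, Matrix.of_apply, aswB1, ← pow_add, powerCoeff_root_pow hf _ (by omega)]
  · exact if_neg (by omega)
  · exact if_pos (by omega)

theorem aswG2_eq_transpose_leftMulMatrix_mul {n : ℕ} (hf : f.Monic)
    (b : Module.Basis (Fin (2 * n + 2)) k (AdjoinRoot f))
    (hb : ∀ i, b i = AdjoinRoot.root f ^ (i : ℕ)) :
    aswG2 n hf = (Algebra.leftMulMatrix b (AdjoinRoot.root f)).transpose * aswG1 n hf := by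
  ext i j
  simp only [Matrix.mul_apply, Matrix.transpose_apply, Algebra.leftMulMatrix_eq_repr_mul, aswG1,
    aswG2, Matrix.of_apply, aswB2, ← hb]
  rw [← aswB1_sum_smul_left, b.sum_repr]

theorem det_asw_pencil {n : ℕ} (hf : f.Monic) (hdeg : f.natDegree = 2 * n + 2) :
    ((X : k[X]) • (aswG1 n hf).map C - (aswG2 n hf).map C).det = (-1 : k[X]) ^ (n + 1) * f := by
  let b := (AdjoinRoot.powerBasis' hf).basis.reindex (finCongr hdeg)
  have hb (i) : b i = AdjoinRoot.root f ^ (i : ℕ) := by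
    rw [Module.Basis.reindex_apply, PowerBasis.basis_eq_pow]
    rfl
  have hpencil : (X : k[X]) • (aswG1 n hf).map C - (aswG2 n hf).map C =
      (Algebra.leftMulMatrix b (AdjoinRoot.root f)).transpose.charmatrix *
        (aswG1 n hf).map C := by
    rw [aswG2_eq_transpose_leftMulMatrix_mul hf b hb, Matrix.map_mul, Matrix.charmatrix, sub_mul,
      Matrix.scalar_apply, ← Matrix.smul_eq_diagonal_mul]
    rfl
  have hdet : ((aswG1 n hf).map C).det = (-1 : k[X]) ^ (n + 1) := by
    rw [← RingHom.mapMatrix_apply, ← RingHom.map_det, det_aswG1 hf hdeg]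
    simp
  rw [hpencil, Matrix.det_mul, hdet, ← Matrix.charpoly, Matrix.charpoly_transpose,
    AdjoinRoot.charpoly_leftMulMatrix_root hf, mul_comm]

end

/-- The Arul–Shankar–Wang construction: on `L = k[X]/(f)` with `f` monic separable of degree
`2n+2`, the form `b₁` is symmetric and nondegenerate, multiplication by `β` is self-adjoint for
`b₁` (so `b₂` is symmetric too), and the pencil `(G₁, G₂)` of Gram matrices satisfies
`det(X·G₁ − G₂) = (−1)^{n+1}·f`. -/
theorem stmt_8 (k : Type*) [Field k] (hchar : ringChar k ≠ 2) (n : ℕ)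
    (f : k[X]) (hmonic : f.Monic) (hsep : f.Separable) (hdeg : f.natDegree = 2 * n + 2) :
    (∀ x y : AdjoinRoot f, aswB1 n hmonic x y = aswB1 n hmonic y x) ∧
    (∀ x : AdjoinRoot f, (∀ y : AdjoinRoot f, aswB1 n hmonic x y = 0) → x = 0) ∧
    (∀ x y : AdjoinRoot f,
      aswB1 n hmonic (AdjoinRoot.root f * x) y = aswB1 n hmonic x (AdjoinRoot.root f * y)) ∧
    (∀ x y : AdjoinRoot f, aswB2 n hmonic x y = aswB2 n hmonic y x) ∧
    ((X : k[X]) • (aswG1 n hmonic).map C - (aswG2 n hmonic).map C).det =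
      (-1 : k[X]) ^ (n + 1) * f := by
  exact ⟨aswB1_comm n hmonic, fun _ => eq_zero_of_forall_aswB1_eq_zero hmonic hdeg,
    aswB1_root_mul_left n hmonic,
    fun x y => (aswB1_root_mul_left n hmonic x y).trans (aswB1_comm n hmonic _ _),
    det_asw_pencil hmonic hdeg⟩
end

section
/- Let k be a field of characteristic ≠ 2, n ≥ 1, and let f ∈ k[X] be a monic separable polynomial of degree 2n+2. Let L = k[X]/(f) with β the image of X, let b₁(x, y) = (the coefficient of β^{2n+1} in x·y with respect to the power basis 1, β, …, β^{2n+1}) and b₂(x, y) = b₁(β·x, y). Then the n-dimensional subspace of L spanned by {1, β, …, β^{n−1}} is totally isotropic for both b₁ and b₂ (both forms vanish identically on it), and the (n+1)-dimensional subspace spanned by {1, β, …, β^n} is totally isotropic for b₁. -/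
open Polynomial

theorem powerCoeff_mk {k : Type*} [Field k] {f : k[X]} (hf : f.Monic) (d : ℕ) {p : k[X]}
    (hp : p.degree < f.degree) : powerCoeff hf d (AdjoinRoot.mk f p) = p.coeff d := by
  rw [powerCoeff, AdjoinRoot.modByMonicHom_mk, (modByMonic_eq_self_iff hf).2 hp]

theorem exists_mk_eq_of_mem_span_root_pow {k : Type*} [Field k] {f : k[X]} {m : ℕ}
    {x : AdjoinRoot f}
    (hx : x ∈ Submodule.span k (Set.range fun i : Fin m => AdjoinRoot.root f ^ (i : ℕ))) :
    ∃ p ∈ degreeLT k m, AdjoinRoot.mk f p = x := by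
  have hle : Submodule.span k (Set.range fun i : Fin m => AdjoinRoot.root f ^ (i : ℕ)) ≤
      (degreeLT k m).map (AdjoinRoot.mkₐ f : k[X] →ₐ[k] AdjoinRoot f).toLinearMap := by
    rw [Submodule.span_le]
    rintro _ ⟨i, rfl⟩
    refine ⟨X ^ (i : ℕ), ?_, by simp⟩
    rw [SetLike.mem_coe, mem_degreeLT, degree_X_pow]
    exact_mod_cast i.2
  obtain ⟨p, hp, rfl⟩ := hle hx
  exact ⟨p, hp, rfl⟩

theorem X_mul_mem_degreeLT {k : Type*} [Field k] {m : ℕ} {p : k[X]} (hp : p ∈ degreeLT k m) :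
    X * p ∈ degreeLT k (m + 1) := by
  rcases eq_or_ne p 0 with rfl | h0
  · simp
  rw [mem_degreeLT, degree_eq_natDegree h0, Nat.cast_lt] at hp
  rw [mem_degreeLT, ← natDegree_lt_iff_degree_lt (mul_ne_zero X_ne_zero h0), natDegree_X_mul h0]
  lia

theorem aswB1_mk_eq_zero {k : Type*} [Field k] {n a b : ℕ} {f : k[X]} (hf : f.Monic)
    (hdeg : f.natDegree = 2 * n + 2) (hab : a + b ≤ 2 * n + 2) {p q : k[X]}
    (hp : p ∈ degreeLT k a) (hq : q ∈ degreeLT k b) :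
    aswB1 n hf (AdjoinRoot.mk f p) (AdjoinRoot.mk f q) = 0 := by
  rcases eq_or_ne p 0 with rfl | hp0
  · simp [aswB1, powerCoeff]
  rcases eq_or_ne q 0 with rfl | hq0
  · simp [aswB1, powerCoeff]
  rw [mem_degreeLT, ← natDegree_lt_iff_degree_lt hp0] at hp
  rw [mem_degreeLT, ← natDegree_lt_iff_degree_lt hq0] at hq
  have hpq : (p * q).natDegree < 2 * n + 1 := by
    rw [natDegree_mul hp0 hq0]
    lia
  rw [aswB1, ← map_mul, powerCoeff_mk hf _ (degree_lt_degree (by lia))]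
  exact coeff_eq_zero_of_natDegree_lt hpq

theorem finrank_span_root_pow {k : Type*} [Field k] {f : k[X]} (hf : f.Monic) {m : ℕ}
    (hm : m ≤ f.natDegree) :
    Module.finrank k
      (Submodule.span k (Set.range fun i : Fin m => AdjoinRoot.root f ^ (i : ℕ))) = m := by
  have hm' : m ≤ (AdjoinRoot.powerBasis' hf).dim := by rwa [AdjoinRoot.powerBasis'_dim]
  have hli := (AdjoinRoot.powerBasis' hf).basis.linearIndependent.comp (Fin.castLE hm')
    (Fin.castLE_injective hm')
  have hpow : (AdjoinRoot.powerBasis' hf).basis ∘ Fin.castLE hm' =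
      fun i : Fin m => AdjoinRoot.root f ^ (i : ℕ) := by
    funext i
    rw [Function.comp_apply, PowerBasis.basis_eq_pow, AdjoinRoot.powerBasis'_gen, Fin.val_castLE]
  rw [hpow] at hli
  rw [finrank_span_eq_card hli, Fintype.card_fin]

/-- The Arul–Shankar–Wang pencil associated to a monic separable `f` of degree `2n+2` is
soluble: the `n`-dimensional subspace of `L = k[X]/(f)` spanned by `1, β, …, β^{n−1}` is
totally isotropic for both `b₁` and `b₂`; moreover `b₁` is hyperbolic: the `(n+1)`-dimensional
subspace spanned by `1, β, …, β^n` is totally isotropic for `b₁`. -/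
theorem stmt_9 (k : Type*) [Field k] (hchar : ringChar k ≠ 2) (n : ℕ) (hn : 1 ≤ n)
    (f : k[X]) (hmonic : f.Monic) (hsep : f.Separable) (hdeg : f.natDegree = 2 * n + 2) :
    Module.finrank k
      (Submodule.span k (Set.range fun i : Fin n => AdjoinRoot.root f ^ (i : ℕ))) = n ∧
    (∀ x ∈ Submodule.span k (Set.range fun i : Fin n => AdjoinRoot.root f ^ (i : ℕ)),
      ∀ y ∈ Submodule.span k (Set.range fun i : Fin n => AdjoinRoot.root f ^ (i : ℕ)),
        aswB1 n hmonic x y = 0 ∧ aswB2 n hmonic x y = 0) ∧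
    Module.finrank k
      (Submodule.span k (Set.range fun i : Fin (n + 1) => AdjoinRoot.root f ^ (i : ℕ))) =
        n + 1 ∧
    (∀ x ∈ Submodule.span k (Set.range fun i : Fin (n + 1) => AdjoinRoot.root f ^ (i : ℕ)),
      ∀ y ∈ Submodule.span k (Set.range fun i : Fin (n + 1) => AdjoinRoot.root f ^ (i : ℕ)),
        aswB1 n hmonic x y = 0) := by
  refine ⟨finrank_span_root_pow hmonic (by lia), fun x hx y hy => ?_,
    finrank_span_root_pow hmonic (by lia), fun x hx y hy => ?_⟩
  · obtain ⟨p, hp, rfl⟩ := exists_mk_eq_of_mem_span_root_pow hx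
    obtain ⟨q, hq, rfl⟩ := exists_mk_eq_of_mem_span_root_pow hy
    refine ⟨aswB1_mk_eq_zero hmonic hdeg (by lia) hp hq, ?_⟩
    rw [aswB2, ← AdjoinRoot.mk_X, ← map_mul]
    exact aswB1_mk_eq_zero hmonic hdeg (by lia) (X_mul_mem_degreeLT hp) hq
  · obtain ⟨p, hp, rfl⟩ := exists_mk_eq_of_mem_span_root_pow hx
    obtain ⟨q, hq, rfl⟩ := exists_mk_eq_of_mem_span_root_pow hy
    exact aswB1_mk_eq_zero hmonic hdeg (by lia) hp hq
end

section
/- Let k be a field of characteristic ≠ 2 and g ≥ 1. Let M₁, M₂ be symmetric (2g+2)×(2g+2) matrices over k such that det(X·M₁ − M₂) ∈ k[X] is separable of degree 2g+2. Let H ⊆ k^{2g+2} be a linear subspace of dimension 2g+1 with basis w₁, …, w_{2g+1}. Then the polynomial det((X·(wᵢᵀM₁wⱼ) − (wᵢᵀM₂wⱼ))_{1 ≤ i,j ≤ 2g+1}) ∈ k[X] is not the zero polynomial; that is, the generic quadric of the pencil restricted to the hyperplane H is nondegenerate. -/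
open Matrix Polynomial

theorem RingHom.map_dotProduct_mulVec {R S m n : Type*} [CommSemiring R] [CommSemiring S]
    [Fintype m] [Fintype n] (f : R →+* S) (v : m → R) (M : Matrix m n R) (w : n → R) :
    f (v ⬝ᵥ M *ᵥ w) = (f ∘ v) ⬝ᵥ M.map f *ᵥ (f ∘ w) := by
  rw [RingHom.map_dotProduct]
  congr 1
  exact funext fun i => RingHom.map_mulVec f M w i

/-- If a symmetric form is degenerate, and so is its restriction to a hyperplane, then its
radical meets the hyperplane nontrivially. -/
theorem Matrix.exists_mem_span_mulVec_eq_zero {K ι n : Type*} [Field K] [Fintype ι] [DecidableEq ι]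
    [Fintype n] [DecidableEq n] (hcard : Fintype.card n = Fintype.card ι + 1)
    {B : Matrix n n K} (hB : B.IsSymm) (hdet : B.det = 0) {w : ι → n → K}
    (hw : LinearIndependent K w) (hres : (Matrix.of fun i j => w i ⬝ᵥ B *ᵥ w j).det = 0) :
    ∃ u ∈ Submodule.span K (Set.range w), u ≠ 0 ∧ B *ᵥ u = 0 := by
  obtain ⟨u, hu, hBu⟩ := exists_mulVec_eq_zero_iff.2 hdet
  by_cases hmem : u ∈ Submodule.span K (Set.range w)
  · exact ⟨u, hmem, hu, hBu⟩
  obtain ⟨y, hy, hWy⟩ := exists_mulVec_eq_zero_iff.2 hres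
  have hspan := (hw.option hmem).span_eq_top_of_card_eq_finrank' (by simp [hcard])
  refine ⟨∑ j, y j • w j, Submodule.sum_mem _ fun j _ =>
    Submodule.smul_mem _ _ (Submodule.subset_span ⟨j, rfl⟩), fun h => hy ?_, ?_⟩
  · exact funext (Fintype.linearIndependent_iff.1 hw y h)
  set h := ∑ j, y j • w j with hh
  have key : ∀ v ∈ Submodule.span K
      (Set.range fun o : Option ι => Option.casesOn' o u w), v ⬝ᵥ B *ᵥ h = 0 := by
    intro v hv
    induction hv using Submodule.span_induction with
    | mem v hv =>
      obtain ⟨_ | i, rfl⟩ := hv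
      · change u ⬝ᵥ B *ᵥ h = 0
        rw [dotProduct_mulVec, ← mulVec_transpose, hB.eq, hBu, zero_dotProduct]
      · change w i ⬝ᵥ B *ᵥ h = 0
        have := congrFun hWy i
        simp only [mulVec, dotProduct, Matrix.of_apply, Pi.zero_apply] at this
        rw [← this, hh, mulVec_sum, dotProduct_sum]
        refine Finset.sum_congr rfl fun j _ => ?_
        rw [mulVec_smul, dotProduct_smul, smul_eq_mul, mul_comm]
        rfl
    | zero => simp
    | add x y _ _ hx hy => rw [add_dotProduct, hx, hy, add_zero]
    | smul c x _ hx => rw [smul_dotProduct, hx, smul_zero]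
  exact dotProduct_eq_zero _ fun v => by
    rw [dotProduct_comm]
    exact key v (hspan ▸ Submodule.mem_top)

/-- Kernel vectors of distinct members of a pencil are linearly independent, provided the member
at infinity is nonsingular. -/
theorem Matrix.linearIndependent_of_smul_sub_mulVec_eq_zero {K ι n : Type*} [Field K]
    [Fintype n] [DecidableEq n] {A B : Matrix n n K} (hA : A.det ≠ 0) {a : ι → K}
    (ha : Function.Injective a) {u : ι → n → K} (hu : ∀ i, u i ≠ 0)
    (h : ∀ i, (a i • A - B) *ᵥ u i = 0) : LinearIndependent K u := by
  refine Module.End.eigenvectors_linearIndependent' (toLin' (A⁻¹ * B)) a ha u fun i =>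
    Module.End.hasEigenvector_iff.2 ⟨Module.End.mem_eigenspace_iff.2 ?_, hu i⟩
  have hi := h i
  rw [sub_mulVec, smul_mulVec, sub_eq_zero] at hi
  rw [toLin'_apply, ← mulVec_mulVec, ← hi, mulVec_smul, mulVec_mulVec,
    nonsing_inv_mul _ (isUnit_iff_ne_zero.2 hA), one_mulVec]

/-- The restricted discriminant is nonzero as soon as the discriminant of the pencil has
as many distinct roots as its degree. -/
theorem Matrix.exists_restrict_det_ne_zero {K ι n : Type*} [Field K] [Fintype ι] [DecidableEq ι]
    [Fintype n] [DecidableEq n] (hcard : Fintype.card n = Fintype.card ι + 1)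
    {A B : Matrix n n K} (hA : A.IsSymm) (hB : B.IsSymm) (hdet : A.det ≠ 0)
    {s : Finset K} (hs : s.card = Fintype.card n) (hroot : ∀ a ∈ s, (a • A - B).det = 0)
    {w : ι → n → K} (hw : LinearIndependent K w) :
    ∃ a ∈ s, (Matrix.of fun i j => w i ⬝ᵥ (a • A - B) *ᵥ w j).det ≠ 0 := by
  by_contra! hres
  choose u hmem hu hker using fun a : s => exists_mem_span_mulVec_eq_zero hcard
    ((hA.smul (a : K)).sub hB) (hroot a a.2) hw (hres a a.2)
  have hli := linearIndependent_of_smul_sub_mulVec_eq_zero hdet Subtype.coe_injective hu hker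
  have hli' : LinearIndependent K
      (fun a => (⟨u a, hmem a⟩ : Submodule.span K (Set.range w))) :=
    LinearIndependent.of_comp (Submodule.subtype _) hli
  have := hli'.fintype_card_le_finrank
  rw [finrank_span_eq_card hw, Fintype.card_coe, hs, hcard] at this
  omega

/-- The restriction of a nonsingular pencil of quadrics on `k^{2g+2}` to any hyperplane
(given by a linearly independent family of `2g+1` vectors) has a generically nondegenerate
quadric: the discriminant of the restricted pencil is a nonzero polynomial. -/
theorem stmt_10 (k : Type*) [Field k] (hchar : ringChar k ≠ 2) (g : ℕ) (hg : 1 ≤ g)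
    (M₁ M₂ : Matrix (Fin (2 * g + 2)) (Fin (2 * g + 2)) k)
    (h₁ : M₁.IsSymm) (h₂ : M₂.IsSymm)
    (hsep : (((X : k[X]) • M₁.map C - M₂.map C).det).Separable)
    (hdeg : (((X : k[X]) • M₁.map C - M₂.map C).det).natDegree = 2 * g + 2)
    (w : Fin (2 * g + 1) → (Fin (2 * g + 2) → k)) (hw : LinearIndependent k w) :
    (Matrix.of fun i j : Fin (2 * g + 1) =>
      (X : k[X]) * C (w i ⬝ᵥ M₁.mulVec (w j)) - C (w i ⬝ᵥ M₂.mulVec (w j))).det ≠ 0 := by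
  classical
  set K := AlgebraicClosure k
  set D := ((X : k[X]) • M₁.map C - M₂.map C).det with hD
  set f := algebraMap k K
  have hdet : M₁.det ≠ 0 := by
    have hcoeff := coeff_det_X_add_C_card M₁ (-M₂)
    rw [show (X : k[X]) • M₁.map C + (-M₂).map C = (X : k[X]) • M₁.map C - M₂.map C by
      ext1 i j
      simp only [sub_eq_add_neg, Matrix.add_apply, Matrix.neg_apply, map_apply, C_neg],
      Fintype.card_fin, ← hD] at hcoeff
    rw [← hcoeff, ← hdeg, coeff_natDegree, leadingCoeff_ne_zero]
    exact hsep.ne_zero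
  have hcard := card_rootSet_eq_natDegree hsep (IsAlgClosed.splits (D.map f))
  obtain ⟨a, -, ha⟩ := exists_restrict_det_ne_zero (K := K) (s := (D.rootSet K).toFinset)
    (A := M₁.map f) (B := M₂.map f) (w := fun i => f ∘ w i) (by simp)
    (h₁.map f) (h₂.map f)
    (by rw [← RingHom.mapMatrix_apply, ← RingHom.map_det]; exact (map_ne_zero f).2 hdet)
    (by rw [Set.toFinset_card, hcard, hdeg, Fintype.card_fin])
    (fun a ha => by
      have h0 := (mem_rootSet.1 (Set.mem_toFinset.1 ha)).2
      rw [aeval_def, ← coe_eval₂RingHom, hD, RingHom.map_det] at h0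
      rw [← h0]
      congr 1
      ext i j
      simp [f, mul_comm a])
    (linearIndependent_algebraMap_comp_iff.2 hw)
  refine fun h0 => ha ?_
  have h1 := congrArg (eval₂RingHom f a) h0
  rw [RingHom.map_det, map_zero] at h1
  rw [← h1]
  congr 1
  ext i j
  simp only [RingHom.mapMatrix_apply, map_apply, of_apply, coe_eval₂RingHom, eval₂_sub, eval₂_mul,
    eval₂_X, eval₂_C]
  simp only [RingHom.map_dotProduct_mulVec, sub_mulVec, smul_mulVec, dotProduct_sub,
    dotProduct_smul, smul_eq_mul]
end

section
/- Let k be a field of characteristic ≠ 2 and g ≥ 1. Let M₁, M₂ be symmetric (2g+2)×(2g+2) matrices over k such that det(X·M₁ − M₂) ∈ k[X] is separable of degree 2g+2. Then every linear subspace L ⊆ k^{2g+2} satisfying vᵀM₁w = 0 and vᵀM₂w = 0 for all v, w ∈ L has dimension at most g. In particular, there is no (g+1)-dimensional subspace isotropic for the pencil. -/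
open Matrix Polynomial

/-- The determinant of a symmetric block matrix with a zero diagonal block of half the size is, up
to sign, a square. -/
theorem Matrix.exists_det_eq_units_mul_sq_of_isSymm {R m : Type*} [CommRing R] [Fintype m]
    [DecidableEq m] (N : Matrix (m ⊕ m) (m ⊕ m) R) (hN : N.IsSymm)
    (h : ∀ i j, N (Sum.inl i) (Sum.inl j) = 0) :
    ∃ u : ℤˣ, N.det = ((u : ℤ) : R) * N.toBlocks₁₂.det ^ 2 := by
  have key : N.submatrix id (Equiv.sumComm m m) =
      fromBlocks N.toBlocks₁₂ 0 N.toBlocks₂₂ N.toBlocks₁₂ᵀ := by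
    ext (i | i) (j | j)
    · rfl
    · exact h i j
    · rfl
    · exact hN.apply _ _
  have hdet := Matrix.det_permute' (Equiv.sumComm m m) N
  rw [key, det_fromBlocks_zero₁₂, det_transpose, ← sq] at hdet
  refine ⟨Equiv.Perm.sign (Equiv.sumComm m m), ?_⟩
  rw [hdet, ← mul_assoc, ← Int.cast_mul, ← Units.val_mul, Int.units_mul_self]
  simp

/-- A subspace of dimension at least `m` in a space of dimension `m + m` contains the first half of
some basis of the whole space. -/
theorem Submodule.exists_basis_sum_inl_mem {k V : Type*} [Field k] [AddCommGroup V] [Module k V]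
    [FiniteDimensional k V] {m : ℕ} (hV : Module.finrank k V = m + m) (L : Submodule k V)
    (hL : m ≤ Module.finrank k L) :
    ∃ b : Module.Basis (Fin m ⊕ Fin m) k V, ∀ i, b (Sum.inl i) ∈ L := by
  obtain ⟨v, hv⟩ := exists_linearIndependent_of_le_finrank hL
  have hv' : LinearIndependent k (L.subtype ∘ v) := hv.map' _ L.ker_subtype
  set W := span k (Set.range (L.subtype ∘ v))
  have hWL : W ≤ L := span_le.2 (by rintro _ ⟨i, rfl⟩; exact (v i).2)
  have hW : Module.finrank k W = m := by
    simpa only [Fintype.card_fin] using finrank_span_eq_card hv'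
  obtain ⟨W', hc⟩ := Submodule.exists_isCompl W
  have hW' : Module.finrank k W' = m := by
    have := Submodule.finrank_add_eq_of_isCompl hc
    omega
  refine ⟨((Module.finBasisOfFinrankEq k W hW).prod (Module.finBasisOfFinrankEq k W' hW')).map
    (Submodule.prodEquivOfIsCompl W W' hc), fun i => ?_⟩
  apply hWL
  simp

/-- A subspace of `k^{2g+2}` isotropic for a nonsingular pencil of quadrics (i.e. totally
isotropic for both `Q₁` and `Q₂`) has dimension at most `g`; in particular there is no
`(g+1)`-dimensional subspace isotropic for the pencil. -/
theorem stmt_11 (k : Type*) [Field k] (hchar : ringChar k ≠ 2) (g : ℕ) (hg : 1 ≤ g)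
    (M₁ M₂ : Matrix (Fin (2 * g + 2)) (Fin (2 * g + 2)) k)
    (h₁ : M₁.IsSymm) (h₂ : M₂.IsSymm)
    (hsep : (((X : k[X]) • M₁.map C - M₂.map C).det).Separable)
    (hdeg : (((X : k[X]) • M₁.map C - M₂.map C).det).natDegree = 2 * g + 2) :
    ∀ L : Submodule k (Fin (2 * g + 2) → k),
      (∀ v ∈ L, ∀ w ∈ L, v ⬝ᵥ M₁.mulVec w = 0 ∧ v ⬝ᵥ M₂.mulVec w = 0) →
      Module.finrank k L ≤ g := by
  intro L hL
  by_contra! hlt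
  obtain ⟨b, hb⟩ := L.exists_basis_sum_inl_mem (m := g + 1) (by simp; omega) hlt
  let e : Fin (g + 1) ⊕ Fin (g + 1) ≃ Fin (2 * g + 2) :=
    finSumFinEquiv.trans (finCongr (by omega))
  let P : Matrix (Fin (2 * g + 2)) (Fin (2 * g + 2)) k :=
    (Pi.basisFun k _).toMatrix (b.reindex e)
  have hP : IsUnit P.det := by
    have := (Pi.basisFun k _).invertibleToMatrix (b.reindex e)
    exact (Matrix.isUnit_iff_isUnit_det _).1 (isUnit_of_invertible P)
  set A := (X : k[X]) • M₁.map C - M₂.map C with hA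
  have hAsymm : A.IsSymm := by
    simp only [Matrix.IsSymm, hA, transpose_sub, transpose_smul, ← transpose_map, h₁.eq, h₂.eq]
  have hentry (M : Matrix (Fin (2 * g + 2)) (Fin (2 * g + 2)) k) (i j) :
      (Pᵀ * M * P) (e i) (e j) = b i ⬝ᵥ M.mulVec (b j) := by
    rw [Matrix.mul_assoc, Matrix.mul_apply']
    simp [dotProduct, mulVec, Matrix.mul_apply, P, Module.Basis.toMatrix_apply]
  let N := (P.map C)ᵀ * A * P.map C
  have hNeq : N = (X : k[X]) • (Pᵀ * M₁ * P).map C - (Pᵀ * M₂ * P).map C := by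
    simp only [N, hA, Matrix.map_mul, transpose_map, Matrix.mul_sub, Matrix.sub_mul,
      Matrix.mul_smul, Matrix.smul_mul]
  have hNsymm : N.IsSymm := by
    simp only [N, Matrix.IsSymm, transpose_mul, transpose_transpose, hAsymm.eq, Matrix.mul_assoc]
  obtain ⟨u, hu⟩ := Matrix.exists_det_eq_units_mul_sq_of_isSymm (N.submatrix e e)
    (hNsymm.submatrix e) fun i j => by
      have := hL _ (hb i) _ (hb j)
      simp [hNeq, hentry, this.1, this.2, -Matrix.map_mul]
  set d := (N.submatrix e e).toBlocks₁₂.det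
  have hdet : C P.det ^ 2 * A.det = ((u : ℤ) : k[X]) * d ^ 2 := by
    rw [← hu, det_submatrix_equiv_self, det_mul, det_mul, det_transpose, ← RingHom.mapMatrix_apply,
      ← RingHom.map_det]
    ring
  have hPC : IsUnit (C P.det ^ 2) := (hP.map C).pow 2
  have hdvd : d * d ∣ A.det := hPC.dvd_mul_left.1 ⟨(u : ℤ), by rw [hdet]; ring⟩
  have hd : IsUnit d := hsep.squarefree d hdvd
  have hAunit : IsUnit A.det := by
    refine isUnit_of_mul_isUnit_right (x := C P.det ^ 2) ?_
    rw [hdet]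
    exact ((u.isUnit).map (Int.castRingHom k[X])).mul (hd.pow 2)
  have := natDegree_eq_zero_of_isUnit hAunit
  omega
end

section
/- Let k be a field of characteristic ≠ 2, g ≥ 1, and let λ₁, …, λ_{2g+2} ∈ k be pairwise distinct. Let Q₁ be the standard form with Gram matrix I and Q₂ the form with Gram matrix D = diag(λ₁, …, λ_{2g+2}). Let ε₁, …, ε_{2g+2} ∈ {1, −1} be signs such that the number of indices i with εᵢ = 1 equals 2p with 0 < 2p < 2g+2, and let σ be the diagonal matrix diag(ε₁, …, ε_{2g+2}). If L ⊆ k^{2g+2} is a linear subspace with σ(L) = L such that vᵀw = 0 and vᵀDw = 0 for all v, w ∈ L, then dim L ≤ g − 1. In particular, σ acts without fixed points on the set of g-dimensional subspaces isotropic for the pencil. -/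
open Matrix

/-- A subspace stable under multiplication by `lam` is stable under multiplication by
polynomials in `lam`. -/
theorem Submodule.eval_mul_mem {k ι : Type*} [Field k] {lam : ι → k} {L : Submodule k (ι → k)}
    (hL : ∀ v ∈ L, lam * v ∈ L) (f : Polynomial k) {v : ι → k} (hv : v ∈ L) :
    (fun i => f.eval (lam i) * v i) ∈ L := by
  induction f using Polynomial.induction_on' with
  | add f₁ f₂ h₁ h₂ =>
    convert L.add_mem h₁ h₂ using 1
    ext i
    simp [add_mul]
  | monomial n a =>
    induction n with
    | zero =>
      convert L.smul_mem a hv using 1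
      ext i
      simp
    | succ n ih =>
      convert hL _ ih using 1
      ext i
      simp only [Polynomial.eval_monomial, Pi.mul_apply]
      ring

/-- A subspace isotropic for the pencil spanned by `1` and `diagonal lam`, with `lam` injective,
has dimension less than half that of the ambient space. -/
theorem two_mul_finrank_lt_of_isotropic {k ι : Type*} [Field k] [Fintype ι] [Nonempty ι]
    {lam : ι → k} (hlam : Function.Injective lam) {L : Submodule k (ι → k)}
    (h₁ : ∀ v ∈ L, ∀ w ∈ L, v ⬝ᵥ w = 0) (h₂ : ∀ v ∈ L, ∀ w ∈ L, v ⬝ᵥ (lam * w) = 0) :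
    2 * Module.finrank k L < Fintype.card ι := by
  classical
  by_contra! hlt
  let B : LinearMap.BilinForm k (ι → k) := Matrix.toBilin' 1
  have hB (v w : ι → k) : B v w = v ⬝ᵥ w := by simp [B, Matrix.toBilin'_apply']
  have hnd : B.Nondegenerate :=
    LinearMap.BilinForm.nondegenerate_toBilin'_of_det_ne_zero' 1 (by simp)
  have hfr := LinearMap.BilinForm.finrank_orthogonal hnd L
  have hle : L ≤ B.orthogonal L := fun v hv w hw => by
    rw [hB]; exact h₁ w hw v hv
  have hEq : L = B.orthogonal L := Submodule.eq_of_le_of_finrank_le hle (by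
    rw [hfr, Module.finrank_fintype_fun_eq_card]; omega)
  have hmul : ∀ v ∈ L, lam * v ∈ L := fun v hv => by
    rw [hEq]
    intro w hw
    rw [hB]
    exact h₂ w hw v hv
  have hbot : L = ⊥ := by
    rw [eq_bot_iff]
    intro v hv
    ext i
    have h := h₁ v hv _ (L.eval_mul_mem hmul (Lagrange.basis Finset.univ lam i) hv)
    rw [dotProduct, Finset.sum_eq_single i] at h
    · simpa [Lagrange.eval_basis_self hlam.injOn (Finset.mem_univ i)] using h
    · intro j _ hj
      simp [Lagrange.eval_basis_of_ne hj.symm (Finset.mem_univ j)]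
    · simp
  have := Fintype.card_pos (α := ι)
  rw [hbot, finrank_bot] at hlt
  omega

/-- If an isotropic subspace for the pencil spanned by `1` and `diagonal lam` is stable under the
projection onto the coordinates in `s`, then its image under this projection has dimension less
than half of the size of `s`. -/
theorem two_mul_finrank_map_funLeft_lt {k ι : Type*} [Field k] [Fintype ι]
    {lam : ι → k} (hlam : Function.Injective lam) {L : Submodule k (ι → k)}
    (h₁ : ∀ v ∈ L, ∀ w ∈ L, v ⬝ᵥ w = 0) (h₂ : ∀ v ∈ L, ∀ w ∈ L, v ⬝ᵥ (lam * w) = 0)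
    {s : Set ι} (hs : s.Nonempty) (hL : ∀ v ∈ L, s.indicator v ∈ L) :
    2 * Module.finrank k (L.map (LinearMap.funLeft k k ((↑) : s → ι))) < s.ncard := by
  classical
  have := hs.to_subtype
  have hsum (v w : ι → k) : ∑ i : s, v i * w i = s.indicator v ⬝ᵥ w := by
    simp only [dotProduct, Set.indicator_apply, ite_mul, zero_mul, ← Finset.sum_filter]
    exact (Finset.sum_subtype (p := (· ∈ s)) _ (by simp) fun i => v i * w i).symm
  rw [← Nat.card_coe_set_eq, Nat.card_eq_fintype_card]
  refine two_mul_finrank_lt_of_isotropic (lam := fun i : s => lam i)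
    (hlam.comp Subtype.val_injective) ?_ ?_
  · rintro _ ⟨v, hv, rfl⟩ _ ⟨w, hw, rfl⟩
    exact (hsum v w).trans (h₁ _ (hL v hv) w hw)
  · rintro _ ⟨v, hv, rfl⟩ _ ⟨w, hw, rfl⟩
    exact (hsum v (lam * w)).trans (h₂ _ (hL v hv) w hw)

/-- The dimension of a space of functions is at most the sum of the dimensions of its
restrictions to a set and to the complement of that set. -/
theorem finrank_le_finrank_map_funLeft_add {k ι : Type*} [Field k] [Finite ι]
    (L : Submodule k (ι → k)) (s : Set ι) :
    Module.finrank k L ≤ Module.finrank k (L.map (LinearMap.funLeft k k ((↑) : s → ι))) +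
      Module.finrank k (L.map (LinearMap.funLeft k k ((↑) : ↥sᶜ → ι))) := by
  rw [← Module.finrank_prod]
  refine LinearMap.finrank_le_finrank_of_injective
    (f := ((LinearMap.funLeft k k ((↑) : s → ι)).submoduleMap L).prod
      ((LinearMap.funLeft k k ((↑) : ↥sᶜ → ι)).submoduleMap L)) ?_
  intro v w h
  obtain ⟨hs, hsc⟩ := Prod.ext_iff.1 h
  ext i
  by_cases hi : i ∈ s
  · exact congrFun (congrArg Subtype.val hs) ⟨i, hi⟩
  · exact congrFun (congrArg Subtype.val hsc) ⟨i, hi⟩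

/-- A `σ`-invariant isotropic subspace for the pencil has dimension at most `g - 1`. -/
theorem finrank_le_of_map_diagonal_eq {k : Type*} [Field k] (hchar : ringChar k ≠ 2) {g : ℕ}
    {lam : Fin (2 * g + 2) → k} (hlam : Function.Injective lam)
    {ε : Fin (2 * g + 2) → k} (hε : ∀ i, ε i = 1 ∨ ε i = -1)
    {p : ℕ} (hp : Set.ncard {i | ε i = 1} = 2 * p)
    (hp0 : 0 < 2 * p) (hp1 : 2 * p < 2 * g + 2) {L : Submodule k (Fin (2 * g + 2) → k)}
    (hσ : Submodule.map (Matrix.diagonal ε).mulVecLin L = L)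
    (hL : ∀ v ∈ L, ∀ w ∈ L, v ⬝ᵥ w = 0 ∧ v ⬝ᵥ (Matrix.diagonal lam).mulVec w = 0) :
    Module.finrank k L + 1 ≤ g := by
  have h2 : (2 : k) ≠ 0 := Ring.two_ne_zero hchar
  have hneg : (-1 : k) ≠ 1 := Ring.neg_one_ne_one_of_char_ne_two hchar
  set s : Set (Fin (2 * g + 2)) := {i | ε i = 1} with hs
  have hsc : sᶜ.ncard = 2 * g + 2 - 2 * p := by
    rw [Set.ncard_compl, hp, Nat.card_fin]
  have hdiag (d v : Fin (2 * g + 2) → k) : (Matrix.diagonal d).mulVec v = d * v := by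
    ext i
    simp [Matrix.mulVec_diagonal]
  have h₁ : ∀ v ∈ L, ∀ w ∈ L, v ⬝ᵥ w = 0 := fun v hv w hw => (hL v hv w hw).1
  have h₂ : ∀ v ∈ L, ∀ w ∈ L, v ⬝ᵥ (lam * w) = 0 := fun v hv w hw => by
    simpa only [hdiag] using (hL v hv w hw).2
  have hind : ∀ v ∈ L, s.indicator v ∈ L := fun v hv => by
    have hσv : ε * v ∈ L := by
      rw [← hdiag, ← hσ]
      exact Submodule.mem_map_of_mem hv
    convert L.smul_mem (2⁻¹ : k) (L.add_mem hv hσv) using 1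
    ext i
    rcases hε i with hi | hi
    · simp [hs, hi, ← two_mul, h2]
    · simp [hs, hi, hneg]
  have hindc : ∀ v ∈ L, sᶜ.indicator v ∈ L := fun v hv => by
    rw [Set.indicator_compl]
    exact L.sub_mem hv (hind v hv)
  have hpos := two_mul_finrank_map_funLeft_lt hlam h₁ h₂
    (Set.nonempty_of_ncard_ne_zero (s := s) (by omega)) hind
  have hnegp := two_mul_finrank_map_funLeft_lt hlam h₁ h₂
    (Set.nonempty_of_ncard_ne_zero (s := sᶜ) (by omega)) hindc
  have := finrank_le_finrank_map_funLeft_add L s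
  omega

/-- For the diagonal nonsingular pencil `t·I − diag(λ₁,…,λ_{2g+2})` with the `λᵢ` pairwise
distinct, and a sign involution `σ = diag(ε₁,…,ε_{2g+2})` with an even number `2p`
(`0 < 2p < 2g+2`) of entries `+1`, every `σ`-invariant subspace isotropic for the pencil has
dimension at most `g − 1`; in particular `σ` acts without fixed points on the set of
`g`-dimensional subspaces isotropic for the pencil. -/
theorem stmt_12 (k : Type*) [Field k] (hchar : ringChar k ≠ 2) (g : ℕ) (hg : 1 ≤ g)
    (lam : Fin (2 * g + 2) → k) (hlam : Function.Injective lam)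
    (ε : Fin (2 * g + 2) → k) (hε : ∀ i, ε i = 1 ∨ ε i = -1)
    (p : ℕ) (hp : Set.ncard {i | ε i = 1} = 2 * p)
    (hp0 : 0 < 2 * p) (hp1 : 2 * p < 2 * g + 2) :
    (∀ L : Submodule k (Fin (2 * g + 2) → k),
      Submodule.map (Matrix.diagonal ε).mulVecLin L = L →
      (∀ v ∈ L, ∀ w ∈ L, v ⬝ᵥ w = 0 ∧ v ⬝ᵥ (Matrix.diagonal lam).mulVec w = 0) →
      Module.finrank k L ≤ g - 1) ∧
    (∀ L : Submodule k (Fin (2 * g + 2) → k),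
      (∀ v ∈ L, ∀ w ∈ L, v ⬝ᵥ w = 0 ∧ v ⬝ᵥ (Matrix.diagonal lam).mulVec w = 0) →
      Module.finrank k L = g →
      Submodule.map (Matrix.diagonal ε).mulVecLin L ≠ L) := by
  refine ⟨fun L hσ hL => ?_, fun L hL hrank hσ => ?_⟩ <;>
  · have := finrank_le_of_map_diagonal_eq hchar hlam hε hp hp0 hp1 hσ hL
    omega
end

section
/- Let k be a field of characteristic ≠ 2 and n ≥ 1. Let M₁, M₂ be symmetric (2n+2)×(2n+2) matrices over k such that the polynomial f(X) := (−1)^{n+1}·det(X·M₁ − M₂) ∈ k[X] is monic, separable and of degree 2n+2. Suppose there exists an n-dimensional subspace L ⊆ k^{2n+2} with vᵀM₁w = 0 and vᵀM₂w = 0 for all v, w ∈ L (the pencil is soluble). Then there exists an (n+1)-dimensional subspace L′ ⊆ k^{2n+2} with vᵀM₁w = 0 for all v, w ∈ L′; that is, the quadratic form Q₁ is hyperbolic. -/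
open Matrix Polynomial

/-- The block swap matrix `[[0, 1], [1, 0]]` has determinant `(-1) ^ card m`. -/
theorem Matrix.det_fromBlocks_zero_one_one_zero {R m : Type*} [CommRing R] [Fintype m]
    [DecidableEq m] :
    (fromBlocks 0 1 1 0 : Matrix (m ⊕ m) (m ⊕ m) R).det = (-1) ^ Fintype.card m := by
  have h : (fromBlocks 0 1 1 0 : Matrix (m ⊕ m) (m ⊕ m) R) * fromBlocks 1 1 0 1 =
      fromBlocks 0 1 1 1 := by
    simp [fromBlocks_multiply]
  have h' := congrArg det h
  rw [det_mul, det_fromBlocks_zero₂₁, det_fromBlocks_one₂₂] at h'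
  simpa [det_neg] using h'

/-- The determinant of a block matrix on `p ⊕ m ⊕ m` which is block anti-triangular when the
blocks are ordered as `m`, `p`, `m`. -/
theorem Matrix.det_of_block_antitriangular {R m p : Type*} [CommRing R] [Fintype m]
    [DecidableEq m] [Fintype p] [DecidableEq p]
    (D : Matrix p p R) (Y : Matrix p m R) (Y' : Matrix m p R) (A A' F : Matrix m m R) :
    (fromBlocks D (fromCols 0 Y) (fromRows 0 Y') (fromBlocks 0 A A' F)).det =
      (-1) ^ Fintype.card m * (D.det * A.det * A'.det) := by
  have h : fromBlocks D (fromCols 0 Y) (fromRows 0 Y') (fromBlocks 0 A A' F) *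
      fromBlocks 1 0 0 (fromBlocks 0 1 1 0) =
      (fromBlocks (fromBlocks D Y 0 A) 0 (fromCols Y' F) A').submatrix
        (Equiv.sumAssoc p m m).symm (Equiv.sumAssoc p m m).symm := by
    simp only [fromBlocks_multiply, fromCols_mul_fromBlocks]
    ext (i | i | i) (j | j | j) <;> simp
  have h' := congrArg det h
  rw [det_mul, det_fromBlocks_zero₂₁, det_fromBlocks_zero_one_one_zero, det_one, one_mul,
    det_submatrix_equiv_self, det_fromBlocks_zero₁₂, det_fromBlocks_zero₂₁] at h'
  rw [← h', mul_comm, mul_assoc, ← mul_pow]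
  simp

/-- A binary quadratic form `p x² + 2 q x y + r y²` whose discriminant `p r - q²` is minus a
square represents zero nontrivially. -/
theorem exists_binary_isotropic {k : Type*} [Field k] {p q r s : k}
    (h : p * r - q * q = -(s * s)) :
    ∃ x y : k, (x ≠ 0 ∨ y ≠ 0) ∧ p * x * x + 2 * q * x * y + r * y * y = 0 := by
  by_cases hp : p = 0
  · exact ⟨1, 0, by simp, by simp [hp]⟩
  · exact ⟨s - q, p, Or.inr hp, by linear_combination p * h⟩

open Module in
/-- Let `B` be a symmetric bilinear form on a space of dimension `2n + 2` with trivial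
discriminant, i.e. with a Gram determinant equal to `(-1) ^ (n + 1)`. If `B` has a totally
isotropic subspace of dimension `n`, then it has one of dimension `n + 1`. -/
theorem LinearMap.BilinForm.exists_isotropic_finrank_succ {k V ι : Type*} [Field k]
    [AddCommGroup V] [Module k V] [Fintype ι] [DecidableEq ι] (b : Basis ι k V)
    {B : LinearMap.BilinForm k V} (hB : B.IsSymm) {n : ℕ} (hV : finrank k V = 2 * n + 2)
    (hdet : (BilinForm.toMatrix b B).det = (-1) ^ (n + 1)) {L : Submodule k V}
    (hL : finrank k L = n) (hiso : ∀ v ∈ L, ∀ w ∈ L, B v w = 0) :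
    ∃ L' : Submodule k V, finrank k L' = n + 1 ∧ ∀ v ∈ L', ∀ w ∈ L', B v w = 0 := by
  have : Module.Finite k V := b.finiteDimensional_of_finite
  have hnd : B.Nondegenerate :=
    (LinearMap.BilinForm.nondegenerate_iff_det_ne_zero b).2 (by simp [hdet])
  have hO : finrank k (B.orthogonal L) = n + 2 := by
    rw [LinearMap.BilinForm.finrank_orthogonal hnd, hV, hL]; lia
  have hle : L ≤ B.orthogonal L := fun v hv w hw => hiso w hw v hv
  have hL₀ : finrank k (L.comap (B.orthogonal L).subtype) = n := by
    rw [(Submodule.comapSubtypeEquivOfLe hle).finrank_eq, hL]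
  have hQ₁ : finrank k (B.orthogonal L ⧸ L.comap (B.orthogonal L).subtype) = 2 := by
    rw [Submodule.finrank_quotient, hO, hL₀]; lia
  have hQ₂ : finrank k (V ⧸ B.orthogonal L) = n := by
    rw [Submodule.finrank_quotient, hO, hV]; lia
  let bL := finBasisOfFinrankEq k _ hL₀
  let bO := Basis.sumQuot bL (finBasisOfFinrankEq k _ hQ₁)
  let c := (Basis.sumQuot bO (finBasisOfFinrankEq k _ hQ₂)).reindex
    (((Equiv.sumComm _ _).sumCongr (Equiv.refl _)).trans (Equiv.sumAssoc (Fin 2) (Fin n) (Fin n)))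
  have hcL (i : Fin n) : c (.inr (.inl i)) = ((bL i : B.orthogonal L) : V) := by simp [c, bO]
  have hcO (i : Fin 2) : c (.inl i) = (bO (.inr i) : V) := by simp [c]
  have hmemL (i : Fin n) : c (.inr (.inl i)) ∈ L := by
    rw [hcL]; exact (bL i).2
  have hmemO (i : Fin 2) : c (.inl i) ∈ B.orthogonal L := by
    rw [hcO]; exact (bO (.inr i)).2
  have hreprL (i : Fin 2) (w : V) (hw : w ∈ L) : c.repr w (.inl i) = 0 := by
    have h := congrArg (fun u : L.comap (B.orthogonal L).subtype => ((u : B.orthogonal L) : V))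
      (bL.sum_repr ⟨⟨w, hle hw⟩, hw⟩)
    simp only [Submodule.coe_sum, Submodule.coe_smul, ← hcL] at h
    rw [← h]
    simp [map_sum]
  let G := BilinForm.toMatrix c B
  have hGsymm : Gᵀ = G := by
    ext i j
    simp [G, BilinForm.toMatrix_apply, hB.eq (c j) (c i)]
  let D : Matrix (Fin 2) (Fin 2) k := G.toBlocks₁₁
  let A : Matrix (Fin n) (Fin n) k := G.toBlocks₂₂.toBlocks₁₂
  have hG : G = fromBlocks D (fromCols 0 G.toBlocks₁₂.toCols₂) (fromRows 0 G.toBlocks₂₁.toRows₂)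
      (fromBlocks 0 A Aᵀ G.toBlocks₂₂.toBlocks₂₂) := by
    ext (i | i | i) (j | j | j)
    · rfl
    · simpa [G, BilinForm.toMatrix_apply] using (hB.eq _ _).symm.trans (hmemO i _ (hmemL j))
    · rfl
    · simpa [G, BilinForm.toMatrix_apply] using hmemO j _ (hmemL i)
    · simpa [G, BilinForm.toMatrix_apply] using hiso _ (hmemL i) _ (hmemL j)
    · rfl
    · rfl
    · exact congrFun (congrFun hGsymm.symm _) _
    · rfl
  let e := c.indexEquiv b
  let P := b.toMatrix (c.reindex e)
  have hdetG : G.det = P.det * P.det * (-1) ^ (n + 1) := by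
    have h₁ : BilinForm.toMatrix (c.reindex e) B = G.submatrix e.symm e.symm := by
      ext i j
      simp [G, BilinForm.toMatrix_apply]
    have h₂ := congrArg det (LinearMap.BilinForm.toMatrix_mul_basis_toMatrix b (c.reindex e) B)
    rw [h₁, det_submatrix_equiv_self, det_mul, det_mul, det_transpose, hdet] at h₂
    rw [← h₂]
    ring
  have hdetG' : G.det = (-1) ^ n * (D.det * A.det * A.det) := by
    rw [hG, det_of_block_antitriangular, det_transpose, Fintype.card_fin]
  have hG₀ : G.det ≠ 0 := (LinearMap.BilinForm.nondegenerate_iff_det_ne_zero c).1 hnd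
  have hA : A.det ≠ 0 := by
    intro h
    simp [hdetG', h] at hG₀
  have hDA : D.det * A.det * A.det = -(P.det * P.det) := by
    have h : (-1 : k) ^ n ≠ 0 := by simp
    apply mul_left_cancel₀ h
    rw [← hdetG', hdetG]
    ring
  have hD : D 0 0 * D 1 1 - D 0 1 * D 0 1 = -((P.det / A.det) * (P.det / A.det)) := by
    have h : D 1 0 = D 0 1 := congrFun (congrFun hGsymm (.inl 0)) (.inl 1)
    rw [det_fin_two, h] at hDA
    field_simp
    linear_combination hDA
  obtain ⟨x, y, hxy, hzero⟩ := exists_binary_isotropic hD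
  let v := x • c (.inl 0) + y • c (.inl 1)
  have hvO : v ∈ B.orthogonal L :=
    add_mem (Submodule.smul_mem _ _ (hmemO 0)) (Submodule.smul_mem _ _ (hmemO 1))
  have hvv : B v v = 0 := by
    have h (i j : Fin 2) : B (c (.inl i)) (c (.inl j)) = D i j := by
      simp [D, G, toBlocks₁₁, BilinForm.toMatrix_apply]
    have h' : D 1 0 = D 0 1 := congrFun (congrFun hGsymm (.inl 0)) (.inl 1)
    simp only [v, map_add, map_smul, LinearMap.add_apply, LinearMap.smul_apply, h, h', smul_eq_mul]
    linear_combination hzero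
  have hvL : v ∉ L := by
    intro hv
    have h₀ := hreprL 0 v hv
    have h₁ := hreprL 1 v hv
    simp [v] at h₀ h₁
    simp [h₀, h₁] at hxy
  refine ⟨L ⊔ k ∙ v, by rw [Submodule.finrank_sup_span_singleton hvL, hL], ?_⟩
  intro u' hu w' hw
  obtain ⟨u, huL, _, hu', rfl⟩ := Submodule.mem_sup.1 hu
  obtain ⟨w, hwL, _, hw', rfl⟩ := Submodule.mem_sup.1 hw
  obtain ⟨s, rfl⟩ := Submodule.mem_span_singleton.1 hu'
  obtain ⟨t, rfl⟩ := Submodule.mem_span_singleton.1 hw'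
  have huv : B u v = 0 := hvO u huL
  have hvw : B v w = 0 := (hB.eq _ _).symm.trans (hvO w hwL)
  simp [hiso u huL w hwL, huv, hvw, hvv]

/-- If a nonsingular pencil of quadrics `t·Q₁ − Q₂` on `k^{2n+2}` with monic separable
discriminant `f(X) = (−1)^{n+1}·det(X·M₁ − M₂)` of degree `2n+2` is soluble (there is an
`n`-dimensional subspace totally isotropic for both forms), then `Q₁` is hyperbolic:
there is an `(n+1)`-dimensional totally isotropic subspace for `Q₁`. -/
theorem stmt_13 (k : Type*) [Field k] (hchar : ringChar k ≠ 2) (n : ℕ) (hn : 1 ≤ n)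
    (M₁ M₂ : Matrix (Fin (2 * n + 2)) (Fin (2 * n + 2)) k)
    (h₁ : M₁.IsSymm) (h₂ : M₂.IsSymm)
    (hmonic : ((-1 : k[X]) ^ (n + 1) * ((X : k[X]) • M₁.map C - M₂.map C).det).Monic)
    (hsep : ((-1 : k[X]) ^ (n + 1) * ((X : k[X]) • M₁.map C - M₂.map C).det).Separable)
    (hdeg : ((-1 : k[X]) ^ (n + 1) *
      ((X : k[X]) • M₁.map C - M₂.map C).det).natDegree = 2 * n + 2)
    (hsol : ∃ L : Submodule k (Fin (2 * n + 2) → k), Module.finrank k L = n ∧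
      ∀ v ∈ L, ∀ w ∈ L, v ⬝ᵥ M₁.mulVec w = 0 ∧ v ⬝ᵥ M₂.mulVec w = 0) :
    ∃ L' : Submodule k (Fin (2 * n + 2) → k), Module.finrank k L' = n + 1 ∧
      ∀ v ∈ L', ∀ w ∈ L', v ⬝ᵥ M₁.mulVec w = 0 := by
  have hdet : M₁.det = (-1) ^ (n + 1) := by
    have h := hmonic.coeff_natDegree
    rw [hdeg, show (-1 : k[X]) ^ (n + 1) = C ((-1) ^ (n + 1)) by simp, coeff_C_mul,
      show M₂.map C = -((-M₂).map C) by ext; simp, sub_neg_eq_add] at h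
    have h' := coeff_det_X_add_C_card M₁ (-M₂)
    rw [Fintype.card_fin] at h'
    rw [h'] at h
    have hs : ((-1 : k) ^ (n + 1)) * (-1) ^ (n + 1) = 1 := by rw [← mul_pow]; simp
    linear_combination (-1) ^ (n + 1) * h - M₁.det * hs
  obtain ⟨L, hL, hiso⟩ := hsol
  have hB : LinearMap.BilinForm.IsSymm (Matrix.toBilin' M₁) := by
    constructor
    intro v w
    simp only [Matrix.toBilin'_apply']
    rw [dotProduct_mulVec, ← mulVec_transpose, h₁.eq, dotProduct_comm]
  obtain ⟨L', hL', hiso'⟩ := LinearMap.BilinForm.exists_isotropic_finrank_succ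
    (Pi.basisFun k (Fin (2 * n + 2))) hB (by simp)
    (by rw [LinearMap.BilinForm.toMatrix_basisFun, LinearMap.BilinForm.toMatrix'_toBilin', hdet]) hL
    (fun v hv w hw => by simpa [Matrix.toBilin'_apply'] using (hiso v hv w hw).1)
  exact ⟨L', hL', fun v hv w hw => by simpa [Matrix.toBilin'_apply'] using hiso' v hv w hw⟩
end
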